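/- (Risk-averse recursive feasibility.) Let W = {1, …, M}, δ ∈ (0, 1], and let X_N ⊆ ℝ³ be a robust control invariant set for the dynamics f with input set U. Let (A_{t,j})_{j ∈ W} and (A_{t+1,j})_{j ∈ W} be families of closed convex subsets of the probability simplex Δ_M satisfying A_{t+1,j} ⊆ A_{t,j} for every j ∈ W, and suppose X_N × W ⊆ Ẑ_s((A_{t,j})_j). Suppose the risk-averse horizon-N optimal control problem with ambiguity sets (A_{t,j})_j is feasible at (x, w): there exist inputs u^σ ∈ U and states x^σ indexed by ALL mode sequences σ = (w₁, …, w_k) ∈ W^k, k = 0, …, N, with x^∅ = x, x^{(w₁,…,w_k)} = f(x^{(w₁,…,w_{k−1})}, u^{(w₁,…,w_{k−1})}, w_k), x^σ ∈ X_r for k ≤ N−1, TVAVAR_δ^{A_{t,w_k}}[(g(f(x^σ, u^σ, w')))_{w' ∈ W}] ≤ 0 for k ≤ N−1 (with w₀ := w), and x^σ ∈ X_N for all σ of length N. Then for every w' ∈ W, the risk-averse optimal control problem with ambiguity sets (A_{t+1,j})_j is feasible at (f(x, u^∅, w'), w'). -/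

import Mathlib

open scoped BigOperators

/-- Longitudinal dynamics of the vehicle pair. -/
noncomputable def dyn {M : ℕ} (Ts : ℝ) (c : Fin M → ℝ) (x : ℝ × ℝ × ℝ) (u : ℝ)
    (w : Fin M) : ℝ × ℝ × ℝ :=
  (x.1 + Ts * (x.2.2 - x.2.1), x.2.1 + Ts * u,
    x.2.2 + Ts * (if 0 ≤ c w then c w else c w * x.2.2))

/-- Hard state constraint set `X_r = {x : 0 ≤ x₂ ≤ v_max}`. -/
def Xr (vmax : ℝ) : Set (ℝ × ℝ × ℝ) := {x | 0 ≤ x.2.1 ∧ x.2.1 ≤ vmax}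

/-- Input constraint set `U = [a_min, a_max]`. -/
def Uset (amin amax : ℝ) : Set ℝ := {u | amin ≤ u ∧ u ≤ amax}

/-- Constraint function `g(x) = -x₁`. -/
def gcon (x : ℝ × ℝ × ℝ) : ℝ := -x.1

/-- Probability simplex `Δ_n`. -/
def simplex (n : ℕ) : Set (Fin n → ℝ) := {p | (∑ i, p i) = 1 ∧ ∀ i, 0 ≤ p i}

/-- Average value-at-risk (dual representation). -/
noncomputable def avar {n : ℕ} (δ : ℝ) (p : Fin n → ℝ) (z : Fin n → ℝ) : ℝ :=
  sSup {v | ∃ μ : Fin n → ℝ, (∑ i, μ i) = 1 ∧ (∀ i, 0 ≤ μ i ∧ μ i ≤ p i / δ) ∧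
    v = ∑ i, μ i * z i}

/-- Distributionally robust average value-at-risk over an ambiguity set `A`. -/
noncomputable def tvavar {n : ℕ} (δ : ℝ) (A : Set (Fin n → ℝ)) (z : Fin n → ℝ) : ℝ :=
  sSup {v | ∃ ν ∈ A, v = avar δ ν z}

/-- Robust control invariance of a set `R` for the dynamics with input set `U`. -/
def RCI {M : ℕ} (Ts : ℝ) (c : Fin M → ℝ) (amin amax : ℝ) (R : Set (ℝ × ℝ × ℝ)) : Prop :=
  ∀ x ∈ R, ∃ u ∈ Uset amin amax, ∀ w : Fin M, dyn Ts c x u w ∈ R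

/-- Risk-averse feasibility set `Ẑ_s((A_j)_j)`. -/
noncomputable def ZsHat {M : ℕ} (Ts : ℝ) (c : Fin M → ℝ) (amin amax vmax δ : ℝ)
    (A : Fin M → Set (Fin M → ℝ)) : Set ((ℝ × ℝ × ℝ) × Fin M) :=
  {q | q.1 ∈ Xr vmax ∧ ∃ u ∈ Uset amin amax,
    tvavar δ (A q.2) (fun w' => gcon (dyn Ts c q.1 u w')) ≤ 0}

/-- Last mode of the sequence `w :: σ`. -/
def lastMode {M : ℕ} (w : Fin M) (σ : List (Fin M)) : Fin M := σ.getLastD w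

/-- Feasibility of the horizon-`N` risk-averse optimal control problem at `(x₀, w)`
with ambiguity sets `(A_j)_j`: there exist inputs and states indexed by *all*
mode sequences, satisfying the dynamics, the input/state constraints, the
`TVAVAR` risk constraints, and the terminal constraint `X_N`. -/
noncomputable def FeasibleRA {M : ℕ} (Ts : ℝ) (c : Fin M → ℝ) (amin amax vmax δ : ℝ)
    (A : Fin M → Set (Fin M → ℝ)) (XN : Set (ℝ × ℝ × ℝ)) (N : ℕ)
    (x0 : ℝ × ℝ × ℝ) (w : Fin M) : Prop :=
  ∃ (u : List (Fin M) → ℝ) (xs : List (Fin M) → ℝ × ℝ × ℝ),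
    xs [] = x0 ∧
    (∀ (σ : List (Fin M)) (w' : Fin M), σ.length < N →
      xs (σ ++ [w']) = dyn Ts c (xs σ) (u σ) w') ∧
    (∀ σ : List (Fin M), σ.length < N →
      u σ ∈ Uset amin amax ∧ xs σ ∈ Xr vmax ∧
      tvavar δ (A (lastMode w σ)) (fun w' => gcon (dyn Ts c (xs σ) (u σ) w')) ≤ 0) ∧
    (∀ σ : List (Fin M), σ.length = N → xs σ ∈ XN)

/-- The average value-at-risk of a constant is that constant. -/
lemma avar_const {n : ℕ} {δ : ℝ} (hδ : 0 < δ) (hδ1 : δ ≤ 1) {p : Fin n → ℝ}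
    (hp : p ∈ simplex n) (k : ℝ) : avar δ p (fun _ => k) = k := by
  have hset : {v | ∃ μ : Fin n → ℝ, (∑ i, μ i) = 1 ∧ (∀ i, 0 ≤ μ i ∧ μ i ≤ p i / δ) ∧
      v = ∑ i, μ i * k} = {k} := by
    ext v
    simp only [Set.mem_ofPred_eq, Set.mem_singleton_iff]
    constructor
    · rintro ⟨μ, hμ, -, rfl⟩
      rw [← Finset.sum_mul, hμ, one_mul]
    · rintro rfl
      refine ⟨p, hp.1, fun i => ⟨hp.2 i, ?_⟩, ?_⟩
      · rw [le_div_iff₀ hδ]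
        exact mul_le_of_le_one_right (hp.2 i) hδ1
      · rw [← Finset.sum_mul, hp.1, one_mul]
  rw [avar, hset, csSup_singleton]

/-- The robust average value-at-risk of a constant over a nonempty ambiguity set is that
constant. -/
lemma tvavar_const {n : ℕ} {δ : ℝ} (hδ : 0 < δ) (hδ1 : δ ≤ 1) {A : Set (Fin n → ℝ)}
    (hA : A ⊆ simplex n) (hne : A.Nonempty) (k : ℝ) : tvavar δ A (fun _ => k) = k := by
  have hset : {v | ∃ ν ∈ A, v = avar δ ν (fun _ => k)} = {k} := by
    ext v
    simp only [Set.mem_ofPred_eq, Set.mem_singleton_iff]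
    constructor
    · rintro ⟨ν, hν, rfl⟩
      exact avar_const hδ hδ1 (hA hν) k
    · rintro rfl
      obtain ⟨ν, hν⟩ := hne
      exact ⟨ν, hν, (avar_const hδ hδ1 (hA hν) v).symm⟩
  rw [tvavar, hset, csSup_singleton]

/-- A risk constraint on a constant is preserved when the ambiguity set shrinks. -/
lemma tvavar_const_nonpos_of_subset {n : ℕ} {δ : ℝ} (hδ : 0 < δ) (hδ1 : δ ≤ 1)
    {A A' : Set (Fin n → ℝ)} (hA : A ⊆ simplex n) (hsub : A' ⊆ A) {k : ℝ}
    (h : tvavar δ A (fun _ => k) ≤ 0) : tvavar δ A' (fun _ => k) ≤ 0 := by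
  rcases A'.eq_empty_or_nonempty with rfl | hne
  · simp [tvavar]
  · rw [tvavar_const hδ hδ1 (hsub.trans hA) hne]
    rwa [tvavar_const hδ hδ1 hA (hne.mono hsub)] at h

/-- The constraint value at the successor state depends neither on the input nor on the mode, so
the risk constraint is insensitive to the input. -/
lemma tvavar_gcon_dyn_nonpos_of_subset {M : ℕ} {Ts δ : ℝ} {c : Fin M → ℝ} (hδ : 0 < δ)
    (hδ1 : δ ≤ 1) {A A' : Set (Fin M → ℝ)} (hA : A ⊆ simplex M) (hsub : A' ⊆ A)
    {x : ℝ × ℝ × ℝ} {u : ℝ} (v : ℝ) (h : tvavar δ A (fun w => gcon (dyn Ts c x u w)) ≤ 0) :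
    tvavar δ A' (fun w => gcon (dyn Ts c x v w)) ≤ 0 :=
  tvavar_const_nonpos_of_subset (k := -(x.1 + Ts * (x.2.2 - x.2.1))) hδ hδ1 hA hsub h

lemma lastMode_cons {M : ℕ} (w w' : Fin M) (σ : List (Fin M)) :
    lastMode w (w' :: σ) = lastMode w' σ :=
  List.getLastD_cons ..

/-- **Risk-averse recursive feasibility.** If the ambiguity sets are nested,
`A_{t+1,j} ⊆ A_{t,j}`, `X_N` is robust control invariant and
`X_N × W ⊆ Ẑ_s((A_{t,j})_j)`, then feasibility of the risk-averse OCP at `(x, w)`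
with ambiguity sets `(A_{t,j})_j` and first input `u []` implies, for every
`w' ∈ W`, feasibility at `(f(x, u [], w'), w')` with ambiguity sets
`(A_{t+1,j})_j`. -/
theorem risk_averse_recursive_feasibility {M : ℕ} (Ts : ℝ) (c : Fin M → ℝ)
    (amin amax vmax δ : ℝ)
    (A A' : Fin M → Set (Fin M → ℝ)) (XN : Set (ℝ × ℝ × ℝ)) (N : ℕ) (hN : 1 ≤ N)
    (hTs : 0 < Ts) (hamin : amin ≤ 0) (hamax : 0 ≤ amax) (hvmax : 0 < vmax)
    (hδ : 0 < δ) (hδ1 : δ ≤ 1)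
    (hAsub : ∀ j, A j ⊆ simplex M) (hAclosed : ∀ j, IsClosed (A j))
    (hAconv : ∀ j, Convex ℝ (A j))
    (hA'sub : ∀ j, A' j ⊆ simplex M) (hA'closed : ∀ j, IsClosed (A' j))
    (hA'conv : ∀ j, Convex ℝ (A' j))
    (hnested : ∀ j, A' j ⊆ A j)
    (hXN : RCI Ts c amin amax XN)
    (hXNZs : ∀ y ∈ XN, ∀ j : Fin M, (y, j) ∈ ZsHat Ts c amin amax vmax δ A)
    (x : ℝ × ℝ × ℝ) (w : Fin M)
    (u : List (Fin M) → ℝ) (xs : List (Fin M) → ℝ × ℝ × ℝ)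
    (hinit : xs [] = x)
    (hdyn : ∀ (σ : List (Fin M)) (w' : Fin M), σ.length < N →
      xs (σ ++ [w']) = dyn Ts c (xs σ) (u σ) w')
    (hstage : ∀ σ : List (Fin M), σ.length < N →
      u σ ∈ Uset amin amax ∧ xs σ ∈ Xr vmax ∧
      tvavar δ (A (lastMode w σ)) (fun w' => gcon (dyn Ts c (xs σ) (u σ) w')) ≤ 0)
    (hterm : ∀ σ : List (Fin M), σ.length = N → xs σ ∈ XN) :
    ∀ w' : Fin M,
      FeasibleRA Ts c amin amax vmax δ A' XN N (dyn Ts c x (u []) w') w' := by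
  intro w'
  have hfb : ∃ v : ℝ × ℝ × ℝ → ℝ, ∀ y ∈ XN, v y ∈ Uset amin amax ∧
      ∀ j, dyn Ts c y (v y) j ∈ XN := by
    classical
    choose! v hv using hXN
    exact ⟨v, hv⟩
  obtain ⟨v, hv⟩ := hfb
  have hroot : xs [w'] = dyn Ts c x (u []) w' := by
    have h := hdyn [] w' (by simpa using Nat.lt_of_succ_le hN)
    rwa [List.nil_append, hinit] at h
  refine ⟨fun σ => if σ.length + 1 < N then u (w' :: σ) else v (xs (w' :: σ)),
    fun σ => if σ.length < N then xs (w' :: σ) else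
      dyn Ts c (xs (w' :: σ.dropLast)) (v (xs (w' :: σ.dropLast))) (lastMode w' σ),
    ?_, ?_, ?_, ?_⟩
  · simpa [Nat.lt_of_succ_le hN] using hroot
  · intro σ j hσ
    by_cases h : σ.length + 1 < N
    · simpa [h, hσ] using hdyn (w' :: σ) j (by simpa using h)
    · simp [h, hσ, lastMode, List.getLastD_eq_getLast?]
  · intro σ hσ
    by_cases h : σ.length + 1 < N
    · obtain ⟨hu, hx, hr⟩ := hstage (w' :: σ) (by simpa using h)
      rw [lastMode_cons] at hr
      simp only [if_pos h, if_pos hσ]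
      exact ⟨hu, hx, tvavar_gcon_dyn_nonpos_of_subset hδ hδ1 (hAsub _) (hnested _) _ hr⟩
    · have hy : xs (w' :: σ) ∈ XN := hterm _ (by simp only [List.length_cons]; omega)
      obtain ⟨hx, _, _, hr⟩ := hXNZs _ hy (lastMode w' σ)
      simp only [if_neg h, if_pos hσ]
      exact ⟨(hv _ hy).1, hx,
        tvavar_gcon_dyn_nonpos_of_subset hδ hδ1 (hAsub _) (hnested _) _ hr⟩
  · intro σ hσ
    simp only [hσ, lt_irrefl, if_false]
    exact (hv _ (hterm _ (by simp only [List.length_cons, List.length_dropLast]; omega))).2 _
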